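/- The signalling fraction is convex: for empirical models e1, e2 on a measurement scenario (X, M, O) and λ ∈ [0,1], SF(λ·e1 + (1−λ)·e2) ≤ λ·SF(e1) + (1−λ)·SF(e2). -/

import Mathlib

/-- Joint outcome assignments for the measurements in `U`. -/
abbrev Assign {X : Type} (O : X → Type) (U : Finset X) : Type :=
  (x : {x : X // x ∈ U}) → O x.1

/-- Marginalisation of a (sub)distribution on `O_U` to `O_V` for `V ⊆ U`. -/
noncomputable def marginal {X : Type} [DecidableEq X] {O : X → Type}
    [∀ x, Fintype (O x)] [∀ x, DecidableEq (O x)]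
    {U V : Finset X} (h : V ⊆ U) (d : Assign O U → ℝ) : Assign O V → ℝ :=
  fun t => ∑ s : Assign O U,
    if (fun x : {x : X // x ∈ V} => s ⟨x.1, h x.2⟩) = t then d s else 0

/-- A model on the scenario with contexts `M`: a real-valued table for each context. -/
abbrev Model {X : Type} (O : X → Type) (M : Finset (Finset X)) : Type :=
  (C : {C : Finset X // C ∈ M}) → Assign O C.1 → ℝ

/-- `M` is a covering family of contexts for `X`. -/
def Covers {X : Type} (M : Finset (Finset X)) : Prop :=
  ∀ x : X, ∃ C ∈ M, x ∈ C

/-- An empirical model: each context carries a probability distribution. -/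
def IsEmpirical {X : Type} [DecidableEq X] {O : X → Type} [∀ x, Fintype (O x)]
    {M : Finset (Finset X)} (e : Model O M) : Prop :=
  ∀ C, (∀ s, 0 ≤ e C s) ∧ (∑ s, e C s) = 1

/-- Non-signalling: marginals agree on intersections of contexts. -/
def NonSignalling {X : Type} [DecidableEq X] {O : X → Type}
    [∀ x, Fintype (O x)] [∀ x, DecidableEq (O x)]
    {M : Finset (Finset X)} (e : Model O M) : Prop :=
  ∀ C C' : {C : Finset X // C ∈ M},
    marginal (Finset.inter_subset_left : C.1 ∩ C'.1 ⊆ C.1) (e C) =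
      marginal (Finset.inter_subset_right : C.1 ∩ C'.1 ⊆ C'.1) (e C')

/-- Deterministic: each context carries a Dirac (point-mass) distribution. -/
def Deterministic {X : Type} [DecidableEq X] {O : X → Type} [∀ x, DecidableEq (O x)]
    {M : Finset (Finset X)} (e : Model O M) : Prop :=
  ∀ C, ∃ s₀ : Assign O C.1, ∀ s, e C s = if s = s₀ then 1 else 0

/-- Marginal of a function on global assignments to the context `C`. -/
noncomputable def globMarg {X : Type} [Fintype X] [DecidableEq X] (O : X → Type)
    [∀ x, Fintype (O x)] [∀ x, DecidableEq (O x)]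
    (C : Finset X) (b : (∀ x, O x) → ℝ) : Assign O C → ℝ :=
  fun t => ∑ g : ∀ x, O x,
    if (fun x : {x : X // x ∈ C} => g x.1) = t then b g else 0

/-- The noncontextual fraction. -/
noncomputable def NCF {X : Type} [Fintype X] [DecidableEq X] {O : X → Type}
    [∀ x, Fintype (O x)] [∀ x, DecidableEq (O x)]
    {M : Finset (Finset X)} (e : Model O M) : ℝ :=
  sSup { r | ∃ b : (∀ x, O x) → ℝ, (∀ g, 0 ≤ b g) ∧
    (∀ C : {C : Finset X // C ∈ M}, ∀ t, globMarg O C.1 b t ≤ e C t) ∧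
    r = ∑ g, b g }

/-- The contextual fraction. -/
noncomputable def CF {X : Type} [Fintype X] [DecidableEq X] {O : X → Type}
    [∀ x, Fintype (O x)] [∀ x, DecidableEq (O x)]
    {M : Finset (Finset X)} (e : Model O M) : ℝ :=
  1 - NCF e

/-- The non-signalling fraction. -/
noncomputable def NSF {X : Type} [Fintype X] [DecidableEq X] {O : X → Type}
    [∀ x, Fintype (O x)] [∀ x, DecidableEq (O x)]
    {M : Finset (Finset X)} (e : Model O M) : ℝ :=
  sSup { r | ∃ b : (∀ x, O x) → ℝ,
    (∀ C : {C : Finset X // C ∈ M}, ∀ t,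
      0 ≤ globMarg O C.1 b t ∧ globMarg O C.1 b t ≤ e C t) ∧
    r = ∑ g, b g }

/-- The signalling fraction. -/
noncomputable def SF {X : Type} [Fintype X] [DecidableEq X] {O : X → Type}
    [∀ x, Fintype (O x)] [∀ x, DecidableEq (O x)]
    {M : Finset (Finset X)} (e : Model O M) : ℝ :=
  1 - NSF e

/-- The maximum incompatibility of marginals. -/
noncomputable def MIM {X : Type} [DecidableEq X] {O : X → Type}
    [∀ x, Fintype (O x)] [∀ x, DecidableEq (O x)]
    {M : Finset (Finset X)} (e : Model O M) : ℝ :=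
  sSup { r | ∃ C C' : {C : Finset X // C ∈ M}, C.1 ≠ C'.1 ∧
    ∃ t : Assign O (C.1 ∩ C'.1),
      r = |marginal (Finset.inter_subset_left : C.1 ∩ C'.1 ⊆ C.1) (e C) t -
            marginal (Finset.inter_subset_right : C.1 ∩ C'.1 ⊆ C'.1) (e C') t| }

/-- The generalised total variation distance between two models. -/
noncomputable def tvDist {X : Type} [DecidableEq X] {O : X → Type}
    [∀ x, Fintype (O x)]
    {M : Finset (Finset X)} (e e' : Model O M) : ℝ :=
  sSup { r | ∃ C : {C : Finset X // C ∈ M}, r = (1/2) * ∑ s, |e C s - e' C s| }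

/-- Total weights of the signed global functions whose marginals lie between `0` and `e`. -/
def nsWeights {X : Type} [Fintype X] [DecidableEq X] {O : X → Type}
    [∀ x, Fintype (O x)] [∀ x, DecidableEq (O x)]
    {M : Finset (Finset X)} (e : Model O M) : Set ℝ :=
  { r | ∃ b : (∀ x, O x) → ℝ,
    (∀ C : {C : Finset X // C ∈ M}, ∀ t,
      0 ≤ globMarg O C.1 b t ∧ globMarg O C.1 b t ≤ e C t) ∧
    r = ∑ g, b g }

lemma IsEmpirical.combination {X : Type} [DecidableEq X] {O : X → Type} [∀ x, Fintype (O x)]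
    {M : Finset (Finset X)} {e1 e2 : Model O M} (he1 : IsEmpirical e1)
    (he2 : IsEmpirical e2) {l m : ℝ} (hl : 0 ≤ l) (hm : 0 ≤ m) (hlm : l + m = 1) :
    IsEmpirical (l • e1 + m • e2) := by
  refine fun C => ⟨fun s => ?_, ?_⟩
  · exact add_nonneg (mul_nonneg hl ((he1 C).1 s)) (mul_nonneg hm ((he2 C).1 s))
  · simp [Finset.sum_add_distrib, ← Finset.mul_sum, (he1 C).2, (he2 C).2, hlm]

section

variable {X : Type} [Fintype X] [DecidableEq X] {O : X → Type}
  [∀ x, Fintype (O x)] [∀ x, DecidableEq (O x)] {M : Finset (Finset X)}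

lemma sum_globMarg (C : Finset X) (b : (∀ x, O x) → ℝ) :
    ∑ t, globMarg O C b t = ∑ g, b g := by
  unfold globMarg
  rw [Finset.sum_comm]
  simp

lemma globMarg_combination (C : Finset X) (b c : (∀ x, O x) → ℝ) (l m : ℝ) (t : Assign O C) :
    globMarg O C (fun g => l * b g + m * c g) t = l * globMarg O C b t + m * globMarg O C c t := by
  simp only [globMarg, Finset.mul_sum, ← Finset.sum_add_distrib]
  refine Finset.sum_congr rfl fun g _ => ?_
  split_ifs <;> simp

lemma IsEmpirical.zero_mem_nsWeights {e : Model O M} (he : IsEmpirical e) :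
    0 ∈ nsWeights e :=
  ⟨fun _ => 0, fun C t => by simpa [globMarg] using (he C).1 t, by simp⟩

lemma IsEmpirical.bddAbove_nsWeights {e : Model O M} (he : IsEmpirical e) (hM : M.Nonempty) :
    BddAbove (nsWeights e) := by
  obtain ⟨C, hC⟩ := hM
  refine ⟨1, ?_⟩
  rintro r ⟨b, hb, rfl⟩
  rw [← sum_globMarg C b, ← (he ⟨C, hC⟩).2]
  exact Finset.sum_le_sum fun t _ => (hb ⟨C, hC⟩ t).2

open scoped Pointwise in
lemma nsWeights_combination_subset (e1 e2 : Model O M) {l m : ℝ} (hl : 0 ≤ l) (hm : 0 ≤ m) :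
    l • nsWeights e1 + m • nsWeights e2 ⊆ nsWeights (l • e1 + m • e2) := by
  rintro _ ⟨_, ⟨_, ⟨b, hb, rfl⟩, rfl⟩, _, ⟨_, ⟨c, hc, rfl⟩, rfl⟩, rfl⟩
  refine ⟨fun g => l * b g + m * c g, fun C t => ?_, ?_⟩
  · rw [globMarg_combination]
    exact ⟨add_nonneg (mul_nonneg hl (hb C t).1) (mul_nonneg hm (hc C t).1),
      add_le_add (mul_le_mul_of_nonneg_left (hb C t).2 hl)
        (mul_le_mul_of_nonneg_left (hc C t).2 hm)⟩
  · simp [Finset.sum_add_distrib, Finset.mul_sum]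

open scoped Pointwise in
/-- The non-signalling fraction is concave. -/
lemma NSF_concave (hM : M.Nonempty) {e1 e2 : Model O M} (he1 : IsEmpirical e1)
    (he2 : IsEmpirical e2) {l m : ℝ} (hl : 0 ≤ l) (hm : 0 ≤ m) (hlm : l + m = 1) :
    l * NSF e1 + m * NSF e2 ≤ NSF (l • e1 + m • e2) := by
  change l • sSup (nsWeights e1) + m • sSup (nsWeights e2) ≤ sSup (nsWeights (l • e1 + m • e2))
  have ne1 : (nsWeights e1).Nonempty := ⟨0, he1.zero_mem_nsWeights⟩
  have ne2 : (nsWeights e2).Nonempty := ⟨0, he2.zero_mem_nsWeights⟩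
  rw [← Real.sSup_smul_of_nonneg hl, ← Real.sSup_smul_of_nonneg hm,
    ← csSup_add ne1.smul_set ((he1.bddAbove_nsWeights hM).smul_of_nonneg hl)
      ne2.smul_set ((he2.bddAbove_nsWeights hM).smul_of_nonneg hm)]
  exact csSup_le_csSup ((he1.combination he2 hl hm hlm).bddAbove_nsWeights hM)
    (ne1.smul_set.add ne2.smul_set) (nsWeights_combination_subset e1 e2 hl hm)

end

theorem SF_convex {X : Type} [Fintype X] [DecidableEq X] {O : X → Type}
    [∀ x, Fintype (O x)] [∀ x, DecidableEq (O x)] [∀ x, Nonempty (O x)]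
    {M : Finset (Finset X)} (hM : Covers M)
    (e1 e2 : Model O M) (he1 : IsEmpirical e1) (he2 : IsEmpirical e2)
    (l : ℝ) (hl : l ∈ Set.Icc (0:ℝ) 1) :
    SF (l • e1 + (1-l) • e2) ≤ l * SF e1 + (1-l) * SF e2 := by
  obtain ⟨h0, h1⟩ := hl
  rcases M.eq_empty_or_nonempty with rfl | hne
  · have h2 : e2 = e1 := funext fun C => absurd C.2 (Finset.notMem_empty _)
    have h3 : l • e1 + (1 - l) • e1 = e1 := by rw [← add_smul]; simp
    rw [h2, h3]
    exact le_of_eq (by ring)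
  · have h := NSF_concave hne he1 he2 h0 (sub_nonneg.2 h1) (by ring)
    unfold SF
    linarith
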